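/- arXiv:1801.03520 — 3 statements merged into one kernel-verified Lean document; each statement's English description precedes it below -/
import Mathlib

section
/- Let K ≥ 3 be an integer and let T ≥ 0 be a real number. Suppose p, q ∈ ℝ satisfy, for every n ∈ {1, …, K}, the linear inequality (sin(2nπ/K) − sin(2(n−1)π/K))·p − (cos(2nπ/K) − cos(2(n−1)π/K))·q ≤ sin(2π/K)·T. Then p² + q² ≤ T². (The K linear inequalities, whose boundary lines pass through consecutive vertices of the regular K-gon inscribed in the circle of radius T, form an inner approximation of the disk of radius T.) -/
open Real

/-- Polar coordinates with the angle in `[0, 2π)`. -/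
theorem exists_polar_coordinates (p q : ℝ) :
    ∃ r α : ℝ, 0 ≤ r ∧ 0 ≤ α ∧ α < 2 * π ∧ p = r * cos α ∧ q = r * sin α := by
  have hp : p = ‖(⟨p, q⟩ : ℂ)‖ * cos (Complex.arg ⟨p, q⟩) :=
    (Complex.norm_mul_cos_arg ⟨p, q⟩).symm
  have hq : q = ‖(⟨p, q⟩ : ℂ)‖ * sin (Complex.arg ⟨p, q⟩) :=
    (Complex.norm_mul_sin_arg ⟨p, q⟩).symm
  have hlow := Complex.neg_pi_lt_arg ⟨p, q⟩
  have hupp := Complex.arg_le_pi ⟨p, q⟩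
  have hpi := pi_pos
  by_cases harg : 0 ≤ Complex.arg ⟨p, q⟩
  · exact ⟨_, _, norm_nonneg _, harg, by linarith, hp, hq⟩
  · refine ⟨_, Complex.arg ⟨p, q⟩ + 2 * π, norm_nonneg (⟨p, q⟩ : ℂ), by linarith,
      by linarith, ?_, ?_⟩
    · rwa [cos_add_two_pi]
    · rwa [sin_add_two_pi]

/-- The `K` linear inequalities whose boundary lines pass through consecutive
vertices of the regular `K`-gon inscribed in the circle of radius `T` form an inner
approximation of the disk of radius `T`: any `(p, q)` satisfying them all has `p² + q² ≤ T²`. -/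
theorem stmt9 (K : ℕ) (hK : 3 ≤ K) (T : ℝ) (hT : 0 ≤ T) (p q : ℝ)
    (h : ∀ n : ℕ, 1 ≤ n → n ≤ K →
      (Real.sin (2 * (n : ℝ) * π / K) - Real.sin (2 * ((n : ℝ) - 1) * π / K)) * p -
          (Real.cos (2 * (n : ℝ) * π / K) - Real.cos (2 * ((n : ℝ) - 1) * π / K)) * q ≤
        Real.sin (2 * π / K) * T) :
    p ^ 2 + q ^ 2 ≤ T ^ 2 := by
  obtain ⟨r, α, hr, hα0, hα, rfl, rfl⟩ := exists_polar_coordinates p q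
  have hpi := pi_pos
  have hK3 : (3 : ℝ) ≤ K := by exact_mod_cast hK
  have hK0 : (0 : ℝ) < K := by linarith
  obtain ⟨δ, hδ⟩ : ∃ δ, δ = π / K := ⟨_, rfl⟩
  have hδ0 : 0 < δ := hδ ▸ div_pos hpi hK0
  have hKδ : K * δ = π := by rw [hδ]; field_simp
  have hδ2 : δ < π / 2 := by nlinarith
  have hm_le : (⌊α / (2 * δ)⌋₊ : ℝ) ≤ α / (2 * δ) := Nat.floor_le (by positivity)
  have hm_lt := Nat.lt_floor_add_one (α / (2 * δ))
  have hmK : ⌊α / (2 * δ)⌋₊ < K := by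
    rw [Nat.floor_lt (by positivity), div_lt_iff₀ (by positivity)]
    linarith
  generalize ⌊α / (2 * δ)⌋₊ = m at hm_le hm_lt hmK
  rw [le_div_iff₀ (by positivity)] at hm_le
  rw [div_lt_iff₀ (by positivity)] at hm_lt
  have hn := h (m + 1) (by omega) hmK
  obtain ⟨φ, hφ⟩ : ∃ φ, φ = (2 * m + 1) * δ := ⟨_, rfl⟩
  have e1 : 2 * ((m + 1 : ℕ) : ℝ) * π / K = φ + δ := by rw [hφ, hδ]; push_cast; ring
  have e2 : 2 * (((m + 1 : ℕ) : ℝ) - 1) * π / K = φ - δ := by rw [hφ, hδ]; push_cast; ring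
  have e3 : 2 * π / K = 2 * δ := by rw [hδ]; ring
  rw [e1, e2, e3, sin_add, sin_sub, cos_add, cos_sub, sin_two_mul] at hn
  have hsin : 0 < sin δ := sin_pos_of_pos_of_lt_pi hδ0 (by linarith)
  have hcos : 0 < cos δ := cos_pos_of_mem_Ioo ⟨by linarith, hδ2⟩
  have hedge : r * cos (α - φ) ≤ cos δ * T := by
    rw [cos_sub]
    refine le_of_mul_le_mul_left ?_ hsin
    linarith
  have hclose : cos δ ≤ cos (α - φ) := by
    rw [← cos_abs (α - φ)]
    refine cos_le_cos_of_nonneg_of_le_pi (abs_nonneg _) (by linarith) ?_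
    rw [abs_le]
    constructor <;> linarith
  have hrT : r ≤ T := by
    refine le_of_mul_le_mul_left ?_ hcos
    linarith [mul_le_mul_of_nonneg_left hclose hr]
  calc (r * cos α) ^ 2 + (r * sin α) ^ 2 = r ^ 2 := by
        linear_combination r ^ 2 * sin_sq_add_cos_sq α
    _ ≤ T ^ 2 := pow_le_pow_left₀ hr hrT 2
end

section
/- Let α = e^{−2πi/3} ∈ ℂ and let γ be the 3 × 3 complex matrix with rows (1, α², α), (α, 1, α²), (α², α, 1). Let V = (V_a, V_b, V_c) ∈ ℂ³ satisfy the balanced-voltage condition V_b = α·V_a and V_c = α²·V_a, and let I = (I_a, I_b, I_c) ∈ ℂ³ be arbitrary. Then V Iᴴ = γ · diag(s), where s = (V_a·conj(I_a), V_b·conj(I_b), V_c·conj(I_c)) is the vector of diagonal entries of V Iᴴ and diag(s) is the 3 × 3 diagonal matrix with s on its diagonal. (Hence, under balanced voltages, S_{e,i} = γ·diag(s_{e,i}) holds exactly.) -/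
open Matrix

/-- Under balanced voltages (`V_b = α·V_a`, `V_c = α²·V_a` with
`α = e^{−2πi/3}`), the matrix of complex powers satisfies `V Iᴴ = γ·diag(s)` exactly, where
`s` is the vector of diagonal entries of `V Iᴴ` and `γ` is the matrix with rows
`(1, α², α), (α, 1, α²), (α², α, 1)`. -/
theorem stmt12 (α : ℂ) (hα : α = Complex.exp (-(2 * Real.pi * Complex.I) / 3))
    (γ : Matrix (Fin 3) (Fin 3) ℂ)
    (hγ : γ = !![1, α ^ 2, α; α, 1, α ^ 2; α ^ 2, α, 1])
    (V I : Matrix (Fin 3) (Fin 1) ℂ)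
    (hVb : V 1 0 = α * V 0 0) (hVc : V 2 0 = α ^ 2 * V 0 0)
    (s : Fin 3 → ℂ) (hs : s = fun k => V k 0 * (starRingEnd ℂ) (I k 0)) :
    V * Iᴴ = γ * Matrix.diagonal s := by
  have hα3 : α ^ 3 = 1 := by
    rw [hα, ← Complex.exp_nat_mul, Complex.exp_eq_one_iff]
    exact ⟨-1, by push_cast; ring⟩
  subst hγ hs
  ext i j
  rw [Matrix.mul_diagonal]
  simp only [Matrix.mul_apply, Fin.sum_univ_one, Matrix.conjTranspose_apply, ← starRingEnd_apply]
  rw [← mul_assoc]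
  congr 1
  clear hα
  fin_cases i <;> fin_cases j <;> simp [hVb, hVc] <;> grind
end

section
/- Let V be a finite set of nodes, let s₀ ∈ V be a distinguished source node, and let f : V × V → ℝ be skew-symmetric (f(u,v) = −f(v,u) for all u, v). Suppose flow conservation holds with nonnegative consumptions: for every node v ≠ s₀, Σ_{u ∈ V} f(u,v) = γ(v), where γ(v) ≥ 0. Then for every node v ≠ s₀ with γ(v) > 0, there exists a finite sequence of nodes s₀ = u_0, u_1, …, u_k = v such that f(u_{t−1}, u_t) > 0 for every t ∈ {1, …, k}; i.e., v is reachable from s₀ along edges carrying strictly positive flow. -/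
/-- The total internal flow of a skew-symmetric function on a finite set vanishes. -/
theorem Finset.sum_sum_eq_zero_of_skew {V : Type*} {f : V → V → ℝ}
    (hskew : ∀ u v, f u v = -f v u) (s : Finset V) :
    ∑ w ∈ s, ∑ u ∈ s, f u w = 0 := by
  have h : ∑ w ∈ s, ∑ u ∈ s, f u w = -∑ w ∈ s, ∑ u ∈ s, f u w := by
    conv_lhs => rw [Finset.sum_comm]
    simp only [← Finset.sum_neg_distrib]
    exact Finset.sum_congr rfl fun u _ => Finset.sum_congr rfl fun w _ => hskew u w
  linarith

/-- If no positive flow enters `s`, then the net inflow into `s` is nonpositive. -/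
theorem Finset.sum_inflow_nonpos_of_skew {V : Type*} [Fintype V] {f : V → V → ℝ}
    (hskew : ∀ u v, f u v = -f v u) (s : Finset V)
    (hs : ∀ u ∉ s, ∀ w ∈ s, f u w ≤ 0) :
    ∑ w ∈ s, ∑ u, f u w ≤ 0 := by
  classical
  simp only [← Finset.sum_add_sum_compl s, Finset.sum_add_distrib,
    Finset.sum_sum_eq_zero_of_skew hskew, zero_add]
  exact Finset.sum_nonpos fun w hw => Finset.sum_nonpos fun u hu =>
    hs u (Finset.mem_compl.mp hu) w hw

/-- Validity of the single-commodity flow model for connectivity. If `f` is a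
skew-symmetric flow on a finite node set with source `s₀` and every node `v ≠ s₀` consumes a
nonnegative amount `γ v` (flow conservation `Σ_u f(u,v) = γ v`), then every node `v ≠ s₀`
with `γ v > 0` is reachable from `s₀` along edges carrying strictly positive flow. -/
theorem stmt13 {V : Type*} [Fintype V] (s₀ : V) (f : V → V → ℝ)
    (hskew : ∀ u v, f u v = -f v u)
    (γ : V → ℝ) (hγ : ∀ v, v ≠ s₀ → 0 ≤ γ v)
    (hcons : ∀ v, v ≠ s₀ → ∑ u, f u v = γ v) :
    ∀ v, v ≠ s₀ → 0 < γ v →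
      Relation.ReflTransGen (fun a b => 0 < f a b) s₀ v := by
  classical
  intro v _ hv
  by_contra hreach
  let s : Finset V := {w | Relation.ReflTransGen (fun a b => 0 < f a b) w v}
  have hmem : ∀ w, w ∈ s ↔ Relation.ReflTransGen (fun a b => 0 < f a b) w v := by simp [s]
  have hne : ∀ w ∈ s, w ≠ s₀ := by
    rintro w hw rfl
    exact hreach ((hmem w).mp hw)
  have hpos : 0 < ∑ w ∈ s, γ w :=
    Finset.sum_pos' (fun w hw => hγ w (hne w hw)) ⟨v, (hmem v).mpr .refl, hv⟩
  have hnonpos : ∑ w ∈ s, ∑ u, f u w ≤ 0 :=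
    Finset.sum_inflow_nonpos_of_skew hskew s fun u hu w hw => by
      by_contra! h
      exact hu ((hmem u).mpr (.head h ((hmem w).mp hw)))
  rw [Finset.sum_congr rfl fun w hw => hcons w (hne w hw)] at hnonpos
  exact hpos.not_ge hnonpos
end
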